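/- arXiv:1006.2561 — 3 statements merged into one kernel-verified Lean document; each statement's English description precedes it below -/
import Mathlib

section
/- Fix an S_d-EL-labeling λ of the Boolean lattice B_d and S ⊆ [d−1], and let d_1, …, d_t, L_i, Γ_i be as in the associated construction. Then every maximal chain of (B_d)_S is a maximal chain of L_i for some i; consequently ⋃_{i=1}^t Γ_i = Δ((B_d)_S), the order complex of the rank-selected subposet (B_d)_S. -/
/-- The label word of a chain, listed as a list of elements: the list of labels of
consecutive (covering) pairs. -/
def chainWord {α : Type*} (lab : α → α → ℤ) (l : List α) : List ℤ :=
  (l.zip l.tail).map fun p => lab p.1 p.2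

/-- `l` is a saturated chain from `x` to `y`: a list `x = x_0 ⋖ x_1 ⋖ ⋯ ⋖ x_t = y`. -/
def IsSatChain {α : Type*} [PartialOrder α] (x y : α) (l : List α) : Prop :=
  l.Chain' (· ⋖ ·) ∧ l.head? = some x ∧ l.getLast? = some y

/-- `lab` is an EL-labeling: every interval `[x,y]` has a unique saturated chain with
strictly increasing label, and this label lexicographically (strictly) precedes the label
of every other saturated chain of `[x,y]`. -/
def IsELLabeling {α : Type*} [PartialOrder α] (lab : α → α → ℤ) : Prop :=
  ∀ x y : α, x ≤ y →
    (∃! l : List α, IsSatChain x y l ∧ (chainWord lab l).Chain' (· < ·)) ∧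
    ∀ l l' : List α, IsSatChain x y l → (chainWord lab l).Chain' (· < ·) →
      IsSatChain x y l' → l' ≠ l →
      List.Lex (· < ·) (chainWord lab l) (chainWord lab l')

/-- An `S_d`-EL-labeling of a bounded poset: an EL-labeling in which the label of every
maximal chain is a permutation of `[d] = {1,…,d}`. -/
def IsSdELLabeling {α : Type*} [PartialOrder α] [BoundedOrder α] (d : ℕ)
    (lab : α → α → ℤ) : Prop :=
  IsELLabeling lab ∧
    ∀ l : List α, IsSatChain (⊥ : α) (⊤ : α) l →
      (chainWord lab l).Perm ((List.range d).map fun i => (i : ℤ) + 1)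

/-- The descent set of a word `w_1 ⋯ w_n` : the set of `i ∈ {1,…,n−1}` with `w_i > w_{i+1}`
(positions are `1`-based). -/
def wordDescents {β : Type*} [LinearOrder β] [Inhabited β] (w : List β) : Finset ℕ :=
  (Finset.Icc 1 (w.length - 1)).filter fun i => w.getD i default < w.getD (i - 1) default

/-- The rank-selected subchain `c_R` of a chain `c` in `B_d`: the elements of `c` whose
rank (cardinality) lies in `R ∪ {0, d}`. -/
def rsel (d : ℕ) (R : Finset ℕ) (l : List (Finset (Fin d))) : List (Finset (Fin d)) :=
  l.filter fun x => decide (x.card ∈ R ∪ ({0, d} : Finset ℕ))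

/-- The set of maximal chains of the subposet `L_i` of `(B_d)_S`:
`{c_S : c a maximal chain of B_d with c_{[d−1]∖S} = (d_i)_{[d−1]∖S}}`, where `d_i` is the
`i`-th entry of the list `D = [d_1, …, d_t]`. -/
def Mchain (d : ℕ) (S : Finset ℕ) (D : List (List (Finset (Fin d)))) (i : ℕ) :
    Set (List (Finset (Fin d))) :=
  {m | ∃ c : List (Finset (Fin d)), IsSatChain (⊥ : Finset (Fin d)) (⊤ : Finset (Fin d)) c ∧
    rsel d (Finset.Icc 1 (d - 1) \ S) c = rsel d (Finset.Icc 1 (d - 1) \ S) (D.getD i []) ∧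
    m = rsel d S c}

/-- The facets of `Γ_i`: the maximal chains of `L_i` that are not chains of `L_j` for any
`j < i` (a chain of `L_j` is a chain all of whose elements belong to `L_j`, i.e. lie on
some maximal chain of `L_j`). -/
def GammaFacet (d : ℕ) (S : Finset ℕ) (D : List (List (Finset (Fin d)))) (i : ℕ) :
    Set (List (Finset (Fin d))) :=
  {e | e ∈ Mchain d S D i ∧
    ¬ ∃ j < i, ∀ x ∈ e, ∃ m ∈ Mchain d S D j, x ∈ m}

/-- `l = Υ_λ(e)`: `l` is the maximal chain obtained from the chain `e` (which contains
`0̂` and `1̂`) by filling in each gap of `e` with the unique saturated chain of increasing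
`λ`-label of the corresponding interval.  Equivalently (given that `λ` is an
EL-labeling): `l` is a maximal chain containing `e` whose label word has descents only at
positions crossing elements of `e`. -/
def IsUpsilon (d : ℕ) (lab : Finset (Fin d) → Finset (Fin d) → ℤ)
    (e l : List (Finset (Fin d))) : Prop :=
  IsSatChain (⊥ : Finset (Fin d)) (⊤ : Finset (Fin d)) l ∧ e.Sublist l ∧
  ∀ k : ℕ, k + 1 < (chainWord lab l).length →
    (chainWord lab l).getD (k + 1) 0 < (chainWord lab l).getD k 0 →
    l.getD (k + 1) ⊥ ∈ e

/-- `F 0 ⊆ F 1 ⊆ ⋯ ⊆ F d` is a maximal chain of `B_d`, indexed by rank. -/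
def IsRankedChain (d : ℕ) (F : ℕ → Finset (Fin d)) : Prop :=
  (∀ i ≤ d, (F i).card = i) ∧ ∀ i < d, F i ⊆ F (i + 1)

/-- The list `[F 0, …, F d]`. -/
def rankedList (d : ℕ) (F : ℕ → Finset (Fin d)) : List (Finset (Fin d)) :=
  (List.range (d + 1)).map F

namespace IsRankedChain

variable {d : ℕ} {F G : ℕ → Finset (Fin d)}

lemma subset (hF : IsRankedChain d F) {i j : ℕ} (hij : i ≤ j) (hj : j ≤ d) : F i ⊆ F j := by
  induction j, hij using Nat.le_induction with
  | base => exact subset_rfl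
  | succ j _ ih => exact (ih (by omega)).trans (hF.2 j (by omega))

lemma covBy (hF : IsRankedChain d F) {i : ℕ} (hi : i < d) : F i ⋖ F (i + 1) := by
  rw [Finset.covBy_iff_card_sdiff_eq_one]
  refine ⟨hF.2 i hi, ?_⟩
  rw [Finset.card_sdiff_of_subset (hF.2 i hi), hF.1 _ hi, hF.1 _ hi.le]
  omega

lemma zero (hF : IsRankedChain d F) : F 0 = ∅ := Finset.card_eq_zero.1 (hF.1 0 (by omega))

lemma last (hF : IsRankedChain d F) : F d = Finset.univ :=
  Finset.card_eq_iff_eq_univ _ |>.1 (by simpa using hF.1 d le_rfl)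

lemma isSatChain (hF : IsRankedChain d F) : IsSatChain ⊥ ⊤ (rankedList d F) := by
  refine ⟨List.isChain_iff_getElem.2 fun i hi => ?_, ?_, ?_⟩
  · have : i < d := by simpa [rankedList] using hi
    simpa [rankedList] using hF.covBy this
  · simp [rankedList, List.head?_eq_getElem?, hF.zero]
  · simp [rankedList, List.getLast?_eq_getElem?, hF.last]

lemma mem_rsel (hF : IsRankedChain d F) {R : Finset ℕ} {x : Finset (Fin d)} :
    x ∈ rsel d R (rankedList d F) ↔ x = F x.card ∧ (x.card ∈ R ∨ x.card = 0 ∨ x.card = d) := by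
  simp only [rsel, rankedList, List.mem_filter, List.mem_map, List.mem_range, decide_eq_true_eq,
    Finset.mem_union, Finset.mem_insert, Finset.mem_singleton, and_congr_left_iff]
  intro _
  constructor
  · rintro ⟨i, hi, rfl⟩
    rw [hF.1 i (by omega)]
  · intro hx
    exact ⟨x.card, Nat.lt_succ_of_le (by simpa using x.card_le_univ), hx.symm⟩

lemma rsel_congr (hF : IsRankedChain d F) (hG : IsRankedChain d G) {R : Finset ℕ}
    (h : ∀ i ∈ R, i ≤ d → F i = G i) : rsel d R (rankedList d F) = rsel d R (rankedList d G) := by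
  simp only [rsel, rankedList, List.filter_map]
  have hfilter : (List.range (d + 1)).filter
        ((fun x : Finset (Fin d) => decide (x.card ∈ R ∪ {0, d})) ∘ F) =
      (List.range (d + 1)).filter
        ((fun x : Finset (Fin d) => decide (x.card ∈ R ∪ {0, d})) ∘ G) := by
    refine List.filter_congr fun i hi => ?_
    have hi' : i ≤ d := by simpa [Nat.lt_succ_iff] using hi
    simp only [Function.comp, hF.1 i hi', hG.1 i hi']
  rw [hfilter]
  refine List.map_congr_left fun i hi => ?_
  simp only [List.mem_filter, List.mem_range, Function.comp, decide_eq_true_eq, Finset.mem_union,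
    Finset.mem_insert, Finset.mem_singleton] at hi
  obtain ⟨hi, hR⟩ := hi
  rw [hG.1 i (by omega)] at hR
  rcases hR with hR | rfl | rfl
  · exact h i hR (by omega)
  · rw [hF.zero, hG.zero]
  · rw [hF.last, hG.last]

lemma eq_of_rsel_eq (hF : IsRankedChain d F) (hG : IsRankedChain d G) {R : Finset ℕ}
    (h : rsel d R (rankedList d F) = rsel d R (rankedList d G)) {i : ℕ} (hi : i ≤ d)
    (hR : i ∈ R ∨ i = 0 ∨ i = d) : F i = G i := by
  have hmem : F i ∈ rsel d R (rankedList d F) := by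
    rw [hF.mem_rsel, hF.1 i hi]
    exact ⟨rfl, hR⟩
  rw [h, hG.mem_rsel, hF.1 i hi] at hmem
  exact hmem.1

end IsRankedChain

lemma IsSatChain.exists_rankedChain {d : ℕ} {l : List (Finset (Fin d))}
    (hl : IsSatChain ⊥ ⊤ l) : ∃ F, IsRankedChain d F ∧ l = rankedList d F := by
  obtain ⟨hchain, hhead, hlast⟩ := hl
  have hcov := List.isChain_iff_getElem.1 hchain
  rw [List.head?_eq_getElem?, List.getElem?_eq_some_iff] at hhead
  rw [List.getLast?_eq_getElem?, List.getElem?_eq_some_iff] at hlast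
  obtain ⟨hpos, hhead⟩ := hhead
  obtain ⟨hlt, hlast⟩ := hlast
  have hcard : ∀ i (hi : i < l.length), (l[i]).card = i := by
    intro i
    induction i with
    | zero => intro _; simp [hhead]
    | succ i ih =>
      intro hi
      obtain ⟨a, ha, h⟩ := Finset.covBy_iff_exists_insert.1 (hcov i hi)
      rw [← h, Finset.card_insert_of_notMem ha, ih]
  have hlen : l.length = d + 1 := by
    have := hcard _ hlt
    rw [hlast] at this
    simp at this
    omega
  refine ⟨fun i => l.getD i ∅, ⟨fun i hi => ?_, fun i hi => ?_⟩, ?_⟩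
  · simp only
    rw [List.getD_eq_getElem _ _ (by omega), hcard]
  · simp only
    rw [List.getD_eq_getElem _ _ (by omega), List.getD_eq_getElem _ _ (by omega)]
    exact (hcov i (by omega)).le
  · refine List.ext_getElem (by simp [rankedList, hlen]) fun i h₁ h₂ => ?_
    simp [rankedList, h₁]

/-- A chain of subsets of `[d]` extends to a maximal chain of `B_d`. -/
lemma exists_rankedChain_of_isChain {d : ℕ} {c : Set (Finset (Fin d))}
    (hc : IsChain (· ⊆ ·) c) : ∃ F, IsRankedChain d F ∧ ∀ x ∈ c, F x.card = x := by
  obtain ⟨M, hM, hcM⟩ := hc.exists_maxChain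
  have hmem : ∀ z, (∀ m ∈ M, z ⊆ m ∨ m ⊆ z) → z ∈ M := by
    intro z hz
    have := hM.2 (hM.1.insert fun b hb _ => hz b hb) (Set.subset_insert z M)
    rw [this]
    exact Set.mem_insert _ _
  have hcomp : ∀ x ∈ M, ∀ y ∈ M, x.card ≤ y.card → x ⊆ y := by
    intro x hx y hy hxy
    rcases hM.1.total hx hy with h | h
    · exact h
    · exact (Finset.eq_of_subset_of_card_le h hxy).ge
  have hrank : ∀ i ≤ d, ∃ x ∈ M, x.card = i := by
    intro i
    induction i with
    | zero => exact fun _ => ⟨∅, hmem _ fun m _ => Or.inl (Finset.empty_subset m), rfl⟩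
    | succ i ih =>
      intro hi
      obtain ⟨x, hx, hxi⟩ := ih (by omega)
      have hne : {y | y ∈ M ∧ i < y.card}.Nonempty :=
        ⟨Finset.univ, hmem _ fun m _ => Or.inr (Finset.subset_univ m), by simpa using hi⟩
      obtain ⟨y, ⟨hy, hyi⟩, hmin⟩ := Set.exists_min_image _ Finset.card (Set.toFinite _) hne
      obtain ⟨z, hxz, hzy, hz⟩ := Finset.exists_subsuperset_card_eq
        (hcomp x hx y hy (by omega)) (n := i + 1) (by omega) (by omega)
      refine ⟨z, hmem z fun m hm => ?_, hz⟩
      by_cases him : i < m.card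
      · exact Or.inl (hzy.trans (hcomp y hy m hm (hmin m ⟨hm, him⟩)))
      · exact Or.inr ((hcomp m hm x hx (by omega)).trans hxz)
  choose! F hFM hF using hrank
  refine ⟨F, ⟨hF, fun i hi => hcomp _ (hFM i hi.le) _ (hFM _ hi) ?_⟩, fun x hx => ?_⟩
  · rw [hF _ hi.le, hF _ hi]
    omega
  · have hxd : x.card ≤ d := by simpa using x.card_le_univ
    exact Finset.eq_of_subset_of_card_le (hcomp _ (hFM _ hxd) _ (hcM hx) (hF _ hxd).le)
      (hF _ hxd).ge

/-- The label of the `i`-th step of the chain `F`. -/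
def stepLabel {d : ℕ} (lab : Finset (Fin d) → Finset (Fin d) → ℤ) (F : ℕ → Finset (Fin d))
    (i : ℕ) : ℤ := lab (F i) (F (i + 1))

lemma chainWord_rankedList {d : ℕ} (lab : Finset (Fin d) → Finset (Fin d) → ℤ)
    (F : ℕ → Finset (Fin d)) :
    chainWord lab (rankedList d F) = (List.range d).map (stepLabel lab F) := by
  refine List.ext_getElem (by simp [chainWord, rankedList]) fun i h₁ h₂ => ?_
  simp [chainWord, rankedList, stepLabel]

lemma wordDescents_rankedList {d : ℕ} (lab : Finset (Fin d) → Finset (Fin d) → ℤ)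
    (F : ℕ → Finset (Fin d)) (p : ℕ) :
    p ∈ wordDescents (chainWord lab (rankedList d F)) ↔
      p ∈ Finset.Icc 1 (d - 1) ∧ stepLabel lab F p < stepLabel lab F (p - 1) := by
  rw [chainWord_rankedList]
  simp only [wordDescents, List.length_map, List.length_range, Finset.mem_filter,
    and_congr_right_iff]
  intro hp
  rw [Finset.mem_Icc] at hp
  rw [List.getD_eq_getElem _ _ (by simp; omega), List.getD_eq_getElem _ _ (by simp; omega)]
  simp

lemma sum_range_sub_of_eq_off_pair {d p : ℕ} (hp : p + 2 ≤ d) {u v : ℕ → ℤ}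
    (h : ∀ i, i ≠ p → i ≠ p + 1 → u i = v i) :
    ∑ i ∈ Finset.range d, u i - ∑ i ∈ Finset.range d, v i =
      u p - v p + (u (p + 1) - v (p + 1)) := by
  rw [← Finset.sum_sub_distrib, ← Finset.sum_pair (f := fun i => u i - v i) (by omega : p ≠ p + 1)]
  refine (Finset.sum_subset (fun i hi => ?_) fun i _ hi => ?_).symm
  · simp only [Finset.mem_insert, Finset.mem_singleton] at hi
    simp only [Finset.mem_range]
    omega
  · simp only [Finset.mem_insert, Finset.mem_singleton, not_or] at hi
    rw [h i hi.1 hi.2, sub_self]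

namespace IsSdELLabeling

variable {d : ℕ} {lab : Finset (Fin d) → Finset (Fin d) → ℤ}

lemma stepLabel_injOn (hEL : IsSdELLabeling d lab) {F : ℕ → Finset (Fin d)}
    (hF : IsRankedChain d F) {i j : ℕ} (hi : i < d) (hj : j < d)
    (h : stepLabel lab F i = stepLabel lab F j) : i = j := by
  have hperm := hEL.2 _ hF.isSatChain
  rw [chainWord_rankedList] at hperm
  have hnodup : ((List.range d).map (stepLabel lab F)).Nodup :=
    hperm.nodup_iff.2 <| by
      simp only [List.bind_eq_flatMap, List.pure_def, ← List.map_eq_flatMap, List.map_map]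
      exact List.nodup_range.map fun a b hab => by simpa using hab
  exact List.inj_on_of_nodup_map hnodup (by simpa using hi) (by simpa using hj) h

lemma sum_stepLabel_eq (hEL : IsSdELLabeling d lab) {F G : ℕ → Finset (Fin d)}
    (hF : IsRankedChain d F) (hG : IsRankedChain d G) (φ : ℤ → ℤ) :
    ∑ i ∈ Finset.range d, φ (stepLabel lab F i) = ∑ i ∈ Finset.range d, φ (stepLabel lab G i) := by
  have hperm := (hEL.2 _ hF.isSatChain).trans (hEL.2 _ hG.isSatChain).symm
  rw [chainWord_rankedList, chainWord_rankedList] at hperm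
  have := (hperm.map φ).sum_eq
  rw [List.map_map, List.map_map] at this
  exact this

end IsSdELLabeling

lemma eq_of_covBy_of_covBy {d : ℕ} {x y y₁ y₂ z : Finset (Fin d)} (hne : y₁ ≠ y₂)
    (h₁ : x ⋖ y₁) (h₁z : y₁ ⋖ z) (h₂ : x ⋖ y₂) (h₂z : y₂ ⋖ z) (h : x ⋖ y) (hz : y ⋖ z) :
    y = y₁ ∨ y = y₂ := by
  obtain ⟨a₁, ha₁, rfl⟩ := Finset.covBy_iff_exists_insert.1 h₁
  obtain ⟨a₂, ha₂, rfl⟩ := Finset.covBy_iff_exists_insert.1 h₂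
  obtain ⟨a, ha, rfl⟩ := Finset.covBy_iff_exists_insert.1 h
  obtain ⟨b, hb, rfl⟩ := Finset.covBy_iff_exists_insert.1 h₁z
  have h2 : a₂ ∈ insert b (insert a₁ x) := h₂z.le (Finset.mem_insert_self _ _)
  have h3 : a ∈ insert b (insert a₁ x) := hz.le (Finset.mem_insert_self _ _)
  simp only [Finset.mem_insert] at h2 h3
  grind

lemma IsSatChain.eq_triple {d : ℕ} {x y z : Finset (Fin d)} {l : List (Finset (Fin d))}
    (hxy : x ⋖ y) (hyz : y ⋖ z) (hl : IsSatChain x z l) :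
    ∃ w, x ⋖ w ∧ w ⋖ z ∧ l = [x, w, z] := by
  have hcard : z.card = x.card + 2 := by
    obtain ⟨a, ha, rfl⟩ := Finset.covBy_iff_exists_insert.1 hxy
    obtain ⟨b, hb, rfl⟩ := Finset.covBy_iff_exists_insert.1 hyz
    rw [Finset.card_insert_of_notMem hb, Finset.card_insert_of_notMem ha]
  have hstep : ∀ {s t : Finset (Fin d)}, s ⋖ t → t.card = s.card + 1 := by
    intro s t h
    obtain ⟨a, ha, rfl⟩ := Finset.covBy_iff_exists_insert.1 h
    exact Finset.card_insert_of_notMem ha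
  obtain ⟨hchain, hhead, hlast⟩ := hl
  replace hchain : l.IsChain (· ⋖ ·) := hchain
  match l with
  | [] => simp at hhead
  | [u] =>
    simp at hhead hlast
    subst hhead hlast
    omega
  | [u, v] =>
    simp at hhead hlast hchain
    subst hhead hlast
    have := hstep hchain
    omega
  | [u, v, w] =>
    simp at hhead hlast hchain
    subst hhead hlast
    exact ⟨v, hchain.1, hchain.2, rfl⟩
  | u :: v :: w :: t :: r =>
    simp only [List.isChain_cons_cons, List.head?_cons, Option.some.injEq] at hchain hhead
    obtain ⟨huv, hvw, hwt, hr⟩ := hchain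
    subst hhead
    have hlt : List.IsChain (· < ·) (w :: t :: r) :=
      List.isChain_cons_cons.2 ⟨hwt.lt, hr.imp fun _ _ h => h.lt⟩
    have hz : z ∈ t :: r := by
      rw [List.getLast?_cons_cons, List.getLast?_cons_cons, List.getLast?_cons_cons] at hlast
      exact List.mem_of_getLast? hlast
    have := Finset.card_lt_card ((List.pairwise_cons.1 (List.isChain_iff_pairwise.1 hlt)).1 z hz)
    have := hstep huv
    have := hstep hvw
    omega

namespace IsSdELLabeling

variable {d : ℕ} {lab : Finset (Fin d) → Finset (Fin d) → ℤ}

/-- Exactly one of the two maximal chains of a rank two interval has increasing label. -/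
lemma increasing_iff_not_increasing (hEL : IsSdELLabeling d lab) {x y₁ y₂ z : Finset (Fin d)}
    (hne : y₁ ≠ y₂) (h₁ : x ⋖ y₁) (h₁z : y₁ ⋖ z) (h₂ : x ⋖ y₂) (h₂z : y₂ ⋖ z) :
    lab x y₁ < lab y₁ z ↔ ¬ lab x y₂ < lab y₂ z := by
  obtain ⟨l, ⟨hl, hinc⟩, huniq⟩ := (hEL.1 x z (h₁.le.trans h₁z.le)).1
  have hsat : ∀ y, x ⋖ y → y ⋖ z → lab x y < lab y z → [x, y, z] = l := by
    intro y hxy hyz hlt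
    refine huniq _ ⟨⟨?_, rfl, rfl⟩, ?_⟩
    · change List.IsChain _ _
      simp [hxy, hyz]
    · change List.IsChain _ _
      simp [chainWord, hlt]
  constructor
  · intro hlt₁ hlt₂
    have := (hsat y₁ h₁ h₁z hlt₁).trans (hsat y₂ h₂ h₂z hlt₂).symm
    simp at this
    exact hne this
  · intro hnlt
    obtain ⟨y, hy, hyz, rfl⟩ := hl.eq_triple h₁ h₁z
    replace hinc : List.IsChain (· < ·) (chainWord lab [x, y, z]) := hinc
    simp [chainWord] at hinc
    rcases eq_of_covBy_of_covBy hne h₁ h₁z h₂ h₂z hy hyz with rfl | rfl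
    · exact hinc
    · exact absurd hinc hnlt

/-- Replacing the element of rank `p + 1` of a maximal chain by the only other possible one
exchanges the two adjacent labels. -/
lemma exists_swap (hEL : IsSdELLabeling d lab) {F : ℕ → Finset (Fin d)}
    (hF : IsRankedChain d F) {p : ℕ} (hp : p + 2 ≤ d) :
    ∃ G, IsRankedChain d G ∧ (∀ i, i ≠ p + 1 → G i = F i) ∧
      stepLabel lab G p = stepLabel lab F (p + 1) ∧
      stepLabel lab G (p + 1) = stepLabel lab F p := by
  have hc₁ := hF.covBy (i := p) (by omega)
  have hc₂ := hF.covBy (i := p + 1) (by omega)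
  obtain ⟨a, ha, hFa⟩ := Finset.covBy_iff_exists_insert.1 hc₁
  obtain ⟨b, hb, hFb⟩ := Finset.covBy_iff_exists_insert.1 hc₂
  have hbp : b ∉ F p := fun h => hb (hc₁.le h)
  have hba : b ≠ a := by
    rintro rfl
    exact hb (hFa ▸ Finset.mem_insert_self _ _)
  set Y := insert b (F p) with hY
  have hY₁ : F p ⋖ Y := Finset.covBy_iff_exists_insert.2 ⟨b, hbp, rfl⟩
  have hY₂ : Y ⋖ F (p + 2) := Finset.covBy_iff_exists_insert.2
    ⟨a, by simp [hY, hba.symm, ha], by rw [← hFb, ← hFa, hY, Finset.insert_comm]⟩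
  have hne : F (p + 1) ≠ Y := fun h => hb (h ▸ Finset.mem_insert_self _ _)
  set G := Function.update F (p + 1) Y with hG
  have hGp : G (p + 1) = Y := Function.update_self ..
  have hGi : ∀ i, i ≠ p + 1 → G i = F i := fun i hi => Function.update_of_ne hi _ _
  have hGr : IsRankedChain d G := by
    refine ⟨fun i hi => ?_, fun i hi => ?_⟩
    · rcases eq_or_ne i (p + 1) with rfl | h
      · rw [hGp, hY, Finset.card_insert_of_notMem hbp, hF.1 _ (by omega)]
      · rw [hGi i h, hF.1 i hi]
    · rcases eq_or_ne i (p + 1) with rfl | h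
      · rw [hGp, hGi _ (by omega)]
        exact hY₂.le
      · rcases eq_or_ne i p with rfl | h'
        · rw [hGp, hGi _ h]
          exact hY₁.le
        · rw [hGi _ h, hGi _ (by omega)]
          exact hF.2 i hi
  refine ⟨G, hGr, hGi, ?_⟩
  have hoff : ∀ i, i ≠ p → i ≠ p + 1 → stepLabel lab G i = stepLabel lab F i := by
    intro i hi hi'
    rw [stepLabel, stepLabel, hGi i hi', hGi (i + 1) (by omega)]
  have hsum : ∀ φ : ℤ → ℤ, φ (stepLabel lab G p) + φ (stepLabel lab G (p + 1)) =
      φ (stepLabel lab F p) + φ (stepLabel lab F (p + 1)) := by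
    intro φ
    have h₁ := hEL.sum_stepLabel_eq hGr hF φ
    have h₂ := sum_range_sub_of_eq_off_pair hp (u := fun i => φ (stepLabel lab G i))
      (v := fun i => φ (stepLabel lab F i)) fun i hi hi' => by simp only [hoff i hi hi']
    linarith
  have h₁ := hsum id
  have h₂ := hsum (· ^ 2)
  simp only [id] at h₁ h₂
  have hinc := hEL.increasing_iff_not_increasing hne hc₁ hc₂ hY₁ hY₂
  have hFne : stepLabel lab F p ≠ stepLabel lab F (p + 1) := fun h => by
    have := hEL.stepLabel_injOn hF (by omega) (by omega) h
    omega
  have hprod : (stepLabel lab G p - stepLabel lab F p) *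
      (stepLabel lab G p - stepLabel lab F (p + 1)) = 0 := by
    have : 2 * ((stepLabel lab G p - stepLabel lab F p) *
        (stepLabel lab G p - stepLabel lab F (p + 1))) = 0 := by
      linear_combination h₂ + (stepLabel lab G p - stepLabel lab G (p + 1) -
        stepLabel lab F p - stepLabel lab F (p + 1)) * h₁
    omega
  have hGl : stepLabel lab G p = lab (F p) Y := by rw [stepLabel, hGp, hGi _ (by omega)]
  have hGl' : stepLabel lab G (p + 1) = lab Y (F (p + 2)) := by
    rw [stepLabel, hGp, hGi _ (by omega)]
  rw [← hGl, ← hGl'] at hinc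
  change stepLabel lab F p < stepLabel lab F (p + 1) ↔ _ at hinc
  rcases mul_eq_zero.1 hprod with h | h <;> grind

end IsSdELLabeling

/-- A nonempty family of chains has a member minimizing `∑ i * λ_i`. -/
lemma exists_min_weighted_sum {d : ℕ} (lab : Finset (Fin d) → Finset (Fin d) → ℤ)
    {P : (ℕ → Finset (Fin d)) → Prop} (hP : ∃ F, P F) :
    ∃ F, P F ∧ ∀ G, P G → ∑ i ∈ Finset.range d, (i : ℤ) * stepLabel lab F i ≤
      ∑ i ∈ Finset.range d, (i : ℤ) * stepLabel lab G i := by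
  obtain ⟨b, hb⟩ := (Set.finite_range fun q : Finset (Fin d) × Finset (Fin d) =>
    lab q.1 q.2).bddBelow
  obtain ⟨_, ⟨F, hF, rfl⟩, hmin⟩ := Int.exists_least_of_bdd
    (P := fun n => ∃ F, P F ∧ ∑ i ∈ Finset.range d, (i : ℤ) * stepLabel lab F i = n)
    ⟨∑ i ∈ Finset.range d, (i : ℤ) * b, by
      rintro _ ⟨F, _, rfl⟩
      exact Finset.sum_le_sum fun i _ => mul_le_mul_of_nonneg_left (hb ⟨(F i, F (i + 1)), rfl⟩)
        (Int.natCast_nonneg i)⟩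
    (hP.imp' _ fun F hF => ⟨F, hF, rfl⟩)
  exact ⟨F, hF, fun G hG => hmin _ ⟨G, hG, rfl⟩⟩

lemma weighted_sum_swap {d : ℕ} {lab : Finset (Fin d) → Finset (Fin d) → ℤ}
    {F G : ℕ → Finset (Fin d)} {p : ℕ} (hp : p + 2 ≤ d)
    (hoff : ∀ i, i ≠ p + 1 → G i = F i)
    (h₁ : stepLabel lab G p = stepLabel lab F (p + 1))
    (h₂ : stepLabel lab G (p + 1) = stepLabel lab F p) :
    ∑ i ∈ Finset.range d, (i : ℤ) * stepLabel lab G i -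
      ∑ i ∈ Finset.range d, (i : ℤ) * stepLabel lab F i =
      stepLabel lab F p - stepLabel lab F (p + 1) := by
  rw [sum_range_sub_of_eq_off_pair hp fun i hi hi' => by
    rw [stepLabel, stepLabel, hoff i hi', hoff (i + 1) (by omega)]]
  rw [h₁, h₂]
  push_cast
  ring

namespace IsSdELLabeling

variable {d : ℕ} {lab : Finset (Fin d) → Finset (Fin d) → ℤ}

/-- Every maximal chain can be changed at the ranks outside `S` so that its label ascends at
all ranks outside `S`. -/
lemma exists_ascending (hEL : IsSdELLabeling d lab) (S : Finset ℕ) {F : ℕ → Finset (Fin d)}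
    (hF : IsRankedChain d F) :
    ∃ G, IsRankedChain d G ∧ (∀ i ∈ S, G i = F i) ∧
      ∀ p, p + 2 ≤ d → p + 1 ∉ S → stepLabel lab G p < stepLabel lab G (p + 1) := by
  obtain ⟨G, ⟨hG, hGF⟩, hmin⟩ := exists_min_weighted_sum (fun x y => -lab x y)
    (P := fun G => IsRankedChain d G ∧ ∀ i ∈ S, G i = F i) ⟨F, hF, fun _ _ => rfl⟩
  refine ⟨G, hG, hGF, fun p hp hpS => ?_⟩
  by_contra hlt
  have hne : stepLabel lab G p ≠ stepLabel lab G (p + 1) := fun h => by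
    have := hEL.stepLabel_injOn hG (by omega) (by omega) h
    omega
  obtain ⟨H, hH, hHG, h₁, h₂⟩ := hEL.exists_swap hG hp
  have hle := hmin H ⟨hH, fun i hi => by rw [hHG i (ne_of_mem_of_not_mem hi hpS), hGF i hi]⟩
  have heq := weighted_sum_swap hp hHG h₁ h₂
  have hneg : ∀ K : ℕ → Finset (Fin d), ∑ i ∈ Finset.range d, (i : ℤ) *
      stepLabel (fun x y => -lab x y) K i = -∑ i ∈ Finset.range d, (i : ℤ) * stepLabel lab K i := by
    intro K
    simp [stepLabel]
  rw [hneg, hneg] at hle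
  omega

/-- A maximal chain whose label ascends at all ranks outside `S` can be changed at the ranks
in `S` so that its label has descent set exactly `S`. -/
lemma exists_descents_eq (hEL : IsSdELLabeling d lab) {S : Finset ℕ}
    (hS : S ⊆ Finset.Icc 1 (d - 1)) {F : ℕ → Finset (Fin d)} (hF : IsRankedChain d F)
    (hasc : ∀ p, p + 2 ≤ d → p + 1 ∉ S → stepLabel lab F p < stepLabel lab F (p + 1)) :
    ∃ G, IsRankedChain d G ∧ (∀ i ∉ S, G i = F i) ∧
      wordDescents (chainWord lab (rankedList d G)) = S := by
  obtain ⟨G, ⟨hG, hGF, hGasc⟩, hmin⟩ := exists_min_weighted_sum lab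
    (P := fun G => IsRankedChain d G ∧ (∀ i ∉ S, G i = F i) ∧
      ∀ p, p + 2 ≤ d → p + 1 ∉ S → stepLabel lab G p < stepLabel lab G (p + 1))
    ⟨F, hF, fun _ _ => rfl, hasc⟩
  have hdesc : ∀ p, p + 2 ≤ d → p + 1 ∈ S → stepLabel lab G (p + 1) < stepLabel lab G p := by
    intro p hp hpS
    by_contra hnlt
    have hne : stepLabel lab G p ≠ stepLabel lab G (p + 1) := fun h => by
      have := hEL.stepLabel_injOn hG (by omega) (by omega) h
      omega
    have hlt : stepLabel lab G p < stepLabel lab G (p + 1) := by omega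
    obtain ⟨H, hH, hHG, h₁, h₂⟩ := hEL.exists_swap hG hp
    have hoff : ∀ i, i ≠ p → i ≠ p + 1 → stepLabel lab H i = stepLabel lab G i := by
      intro i hi hi'
      rw [stepLabel, stepLabel, hHG i hi', hHG (i + 1) (by omega)]
    have hle := hmin H ⟨hH, fun i hi => by
      rw [hHG i (ne_of_mem_of_not_mem hpS hi).symm, hGF i hi], fun q hq hqS => ?_⟩
    · have heq := weighted_sum_swap hp hHG h₁ h₂
      omega
    · have hqp : q ≠ p := by
        rintro rfl
        exact hqS hpS
      have hq' := hGasc q hq hqS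
      rcases eq_or_ne q (p + 1) with rfl | hq₁
      · rw [h₂, hoff (p + 1 + 1) (by omega) (by omega)]
        omega
      · rw [hoff q hqp hq₁]
        rcases eq_or_ne (q + 1) p with rfl | hq₂
        · rw [h₁]
          omega
        · rw [hoff (q + 1) hq₂ (by omega)]
          exact hq'
  refine ⟨G, hG, hGF, ?_⟩
  ext p
  rw [wordDescents_rankedList]
  constructor
  · rintro ⟨hp, hlt⟩
    by_contra hpS
    obtain ⟨q, rfl⟩ : ∃ q, p = q + 1 := ⟨p - 1, by rw [Finset.mem_Icc] at hp; omega⟩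
    rw [Finset.mem_Icc] at hp
    exact lt_asymm hlt (hGasc q (by omega) hpS)
  · intro hp
    have hp' := Finset.mem_Icc.1 (hS hp)
    refine ⟨hS hp, ?_⟩
    obtain ⟨q, rfl⟩ : ∃ q, p = q + 1 := ⟨p - 1, by omega⟩
    exact hdesc q (by omega) hp

end IsSdELLabeling

lemma mem_Mchain_of_forall_mem {d : ℕ} {S : Finset ℕ} {D : List (List (Finset (Fin d)))} {j : ℕ}
    (hj : IsSatChain ⊥ ⊤ (D.getD j [])) {E : ℕ → Finset (Fin d)} (hE : IsRankedChain d E)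
    (h : ∀ x ∈ rsel d S (rankedList d E), ∃ m ∈ Mchain d S D j, x ∈ m) :
    rsel d S (rankedList d E) ∈ Mchain d S D j := by
  obtain ⟨F, hF, hDF⟩ := hj.exists_rankedChain
  have hcomp : ∀ p ∈ S, p ≤ d → ∃ C, IsRankedChain d C ∧ C p = E p ∧
      ∀ q ∉ S, q ≤ d → C q = F q := by
    intro p hp hpd
    obtain ⟨m, ⟨c, hc, hcD, rfl⟩, hx⟩ := h (E p) (by
      rw [hE.mem_rsel, hE.1 p hpd]
      exact ⟨rfl, Or.inl hp⟩)
    obtain ⟨C, hC, rfl⟩ := hc.exists_rankedChain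
    rw [hDF] at hcD
    rw [hC.mem_rsel, hE.1 p hpd] at hx
    refine ⟨C, hC, hx.1.symm, fun q hq hqd => hC.eq_of_rsel_eq hF hcD hqd ?_⟩
    rw [Finset.mem_sdiff, Finset.mem_Icc]
    by_cases h0 : q = 0
    · exact Or.inr (Or.inl h0)
    · by_cases hd : q = d
      · exact Or.inr (Or.inr hd)
      · exact Or.inl ⟨by omega, hq⟩
  let G : ℕ → Finset (Fin d) := fun i => if i ∈ S then E i else F i
  have hGE : ∀ i ∈ S, G i = E i := fun i hi => if_pos hi
  have hGF : ∀ i ∉ S, G i = F i := fun i hi => if_neg hi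
  have hG : IsRankedChain d G := by
    refine ⟨fun i hi => ?_, fun i hi => ?_⟩
    · by_cases hiS : i ∈ S
      · rw [hGE i hiS, hE.1 i hi]
      · rw [hGF i hiS, hF.1 i hi]
    · by_cases hiS : i ∈ S <;> by_cases hiS' : i + 1 ∈ S
      · rw [hGE _ hiS, hGE _ hiS']
        exact hE.2 i hi
      · obtain ⟨C, hC, hCE, hCF⟩ := hcomp i hiS hi.le
        rw [hGE _ hiS, hGF _ hiS', ← hCE, ← hCF _ hiS' hi]
        exact hC.2 i hi
      · obtain ⟨C, hC, hCE, hCF⟩ := hcomp (i + 1) hiS' hi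
        rw [hGF _ hiS, hGE _ hiS', ← hCE, ← hCF _ hiS hi.le]
        exact hC.2 i hi
      · rw [hGF _ hiS, hGF _ hiS']
        exact hF.2 i hi
  refine ⟨rankedList d G, hG.isSatChain, ?_, hE.rsel_congr hG fun i hi _ => (hGE i hi).symm⟩
  rw [hDF]
  exact hG.rsel_congr hF fun i hi _ => hGF i (Finset.mem_sdiff.1 hi).2

/-- fix an `S_d`-EL-labeling `λ` of `B_d` and `S ⊆ [d−1]`, with the
construction `D = [d_1, …, d_t]`, `L_i`, `Γ_i` as before.  Then every maximal chain of
`(B_d)_S` (i.e. every chain `c_S` for `c` a maximal chain of `B_d`) is a maximal chain of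
`L_i` for some `i`; consequently `⋃_i Γ_i = Δ((B_d)_S)`: a finite set `g` of elements of
`B_d` is a face of `Δ((B_d)_S)` (a chain all of whose elements have rank in `S`) if and
only if it is contained in a facet of some `Γ_i`. -/
theorem gamma_union_eq_rank_selected (d : ℕ)
    (lab : Finset (Fin d) → Finset (Fin d) → ℤ)
    (hEL : IsSdELLabeling d lab) (S : Finset ℕ) (hS : S ⊆ Finset.Icc 1 (d - 1))
    (D : List (List (Finset (Fin d))))
    (hD : ∀ l : List (Finset (Fin d)), l ∈ D ↔
      IsSatChain (⊥ : Finset (Fin d)) (⊤ : Finset (Fin d)) l ∧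
        wordDescents (chainWord lab l) = S)
    (hDnd : D.Nodup)
    (hDlex : D.Pairwise fun l l' => List.Lex (· < ·) (chainWord lab l) (chainWord lab l')) :
    (∀ c : List (Finset (Fin d)),
      IsSatChain (⊥ : Finset (Fin d)) (⊤ : Finset (Fin d)) c →
        ∃ i < D.length, rsel d S c ∈ Mchain d S D i) ∧
    ∀ g : Finset (Finset (Fin d)),
      (IsChain (· ⊆ ·) (g : Set (Finset (Fin d))) ∧ ∀ x ∈ g, x.card ∈ S) ↔
        ∃ i < D.length, ∃ e ∈ GammaFacet d S D i, ∀ x ∈ g, x ∈ e ∧ x.card ∈ S := by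
  have hDsat : ∀ i < D.length, IsSatChain ⊥ ⊤ (D.getD i []) := by
    intro i hi
    rw [List.getD_eq_getElem _ _ hi]
    exact ((hD _).1 (List.getElem_mem hi)).1
  have hcover : ∀ c : List (Finset (Fin d)), IsSatChain ⊥ ⊤ c →
      ∃ i < D.length, rsel d S c ∈ Mchain d S D i := by
    intro c hc
    obtain ⟨F, hF, rfl⟩ := hc.exists_rankedChain
    obtain ⟨F', hF', hFF', hasc⟩ := hEL.exists_ascending S hF
    obtain ⟨G, hG, hGF', hdesc⟩ := hEL.exists_descents_eq hS hF' hasc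
    obtain ⟨i, hi, hDi⟩ := List.getElem_of_mem ((hD _).2 ⟨hG.isSatChain, hdesc⟩)
    refine ⟨i, hi, rankedList d F', hF'.isSatChain, ?_,
      hF.rsel_congr hF' fun p hp _ => (hFF' p hp).symm⟩
    rw [List.getD_eq_getElem _ _ hi, hDi]
    exact hF'.rsel_congr hG fun p hp _ => (hGF' p (Finset.mem_sdiff.1 hp).2).symm
  refine ⟨hcover, fun g => ⟨?_, ?_⟩⟩
  · rintro ⟨hchain, hgS⟩
    classical
    obtain ⟨E, hE, hgE⟩ := exists_rankedChain_of_isChain hchain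
    have hex : ∃ j, j < D.length ∧
        ∀ x ∈ rsel d S (rankedList d E), ∃ m ∈ Mchain d S D j, x ∈ m := by
      obtain ⟨i, hi, hmem⟩ := hcover _ hE.isSatChain
      exact ⟨i, hi, fun x hx => ⟨_, hmem, hx⟩⟩
    obtain ⟨hj, hjmem⟩ := Nat.find_spec hex
    refine ⟨Nat.find hex, hj, rsel d S (rankedList d E),
      ⟨mem_Mchain_of_forall_mem (hDsat _ hj) hE hjmem, ?_⟩, fun x hx => ⟨?_, hgS x hx⟩⟩
    · rintro ⟨i, hi, himem⟩
      exact Nat.find_min hex hi ⟨hi.trans hj, himem⟩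
    · rw [hE.mem_rsel]
      exact ⟨(hgE x hx).symm, Or.inl (hgS x hx)⟩
  · rintro ⟨i, hi, e, ⟨⟨c, hc, -, rfl⟩, -⟩, hg⟩
    obtain ⟨C, hC, rfl⟩ := hc.exists_rankedChain
    refine ⟨fun x hx y hy _ => ?_, fun x hx => (hg x hx).2⟩
    have hxC := (hC.mem_rsel.1 (hg x hx).1).1
    have hyC := (hC.mem_rsel.1 (hg y hy).1).1
    have hxd : x.card ≤ d := by simpa using x.card_le_univ
    have hyd : y.card ≤ d := by simpa using y.card_le_univ
    rw [hxC, hyC]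
    exact (le_total x.card y.card).imp (fun h => hC.subset h hyd) fun h => hC.subset h hxd
end

section
/- Let F_1, …, F_r be a shelling of a pure (d−1)-dimensional simplicial complex Σ, with associated posets P and P_1, …, P_r, and for each i let λ_i be the S_d-EL-labeling of P_i induced by a bijection φ_i: F_i → [d] that labels the vertices of the restriction face r(F_i) last. If e is a non-maximal chain of P_i that is also a chain of P_j for some j < i, then Υ_{λ_i}(e) is a chain of P_k for some k < i. -/
variable {V : Type*} [DecidableEq V]

/-- `K` is a simplicial complex: a collection of finite sets closed under subsets. -/
def IsComplex (K : Finset (Finset V)) : Prop :=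
  ∀ G ∈ K, ∀ H : Finset V, H ⊆ G → H ∈ K

/-- `K` is pure `(d−1)`-dimensional: every face is contained in a face of `d` elements,
and the maximal faces (facets) are exactly the faces of `d` elements. -/
def IsPure (d : ℕ) (K : Finset (Finset V)) : Prop :=
  ∀ G ∈ K, G.card ≤ d ∧ ∃ G' ∈ K, G ⊆ G' ∧ G'.card = d

/-- The list `F = [F_1, …, F_t]` is a shelling of the pure `(d−1)`-dimensional complex
`K`: it enumerates the facets without repetition, and for all `j < k` there is `j' < k`
with `F_j ∩ F_k ⊆ F_{j'} ∩ F_k = F_{j'} − x` for some `x ∈ F_{j'}`. -/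
def IsShelling (d : ℕ) (K : Finset (Finset V)) (F : List (Finset V)) : Prop :=
  F.Nodup ∧ (∀ G : Finset V, G ∈ F ↔ G ∈ K ∧ G.card = d) ∧
    ∀ j k : ℕ, j < k → k < F.length →
      ∃ j' : ℕ, j' < k ∧
        F.getD j ∅ ∩ F.getD k ∅ ⊆ F.getD j' ∅ ∩ F.getD k ∅ ∧
        ∃ x ∈ F.getD j' ∅, F.getD j' ∅ ∩ F.getD k ∅ = (F.getD j' ∅).erase x

/-- `r` is the restriction map of the shelling `F`: `r k` is the unique minimal face of
`F_k` not contained in any earlier facet `F_j`, `j < k`. -/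
def IsRestrictionMap (F : List (Finset V)) (r : ℕ → Finset V) : Prop :=
  ∀ k : ℕ, k < F.length →
    r k ⊆ F.getD k ∅ ∧ (¬ ∃ j < k, r k ⊆ F.getD j ∅) ∧
    ∀ g : Finset V, g ⊆ F.getD k ∅ → (¬ ∃ j < k, g ⊆ F.getD j ∅) → r k ⊆ g

/-- The label word of a saturated chain `l` of subsets of a facet, with respect to a
vertex-labeling `f`: each covering step `a ⋖ b` (with `b ∖ a = {v}`) receives the label
`f v` (realized as the sum of `f` over `b ∖ a`). -/
def faceChainWord (f : V → ℕ) (l : List (Finset V)) : List ℕ :=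
  (l.zip l.tail).map fun p => (p.2 \ p.1).sum f

/-- `l` is a maximal chain of `P_i` (modeled as a full flag of subsets of the facet `A`):
`∅ = x_0 ⊂ x_1 ⊂ ⋯ ⊂ x_d = A` with each step adding one vertex (the top `A` represents
`1̂`). -/
def IsMaxFlag (A : Finset V) (l : List (Finset V)) : Prop :=
  l.Chain' (fun a b => a ⊆ b ∧ b.card = a.card + 1) ∧
    l.head? = some ∅ ∧ l.getLast? = some A

theorem IsMaxFlag.getD_zero {α : Type*} {A : Finset α} {l : List (Finset α)}
    (h : IsMaxFlag A l) : l.getD 0 ∅ = ∅ := by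
  cases l <;> simp_all [IsMaxFlag]

theorem IsMaxFlag.length_pos {α : Type*} {A : Finset α} {l : List (Finset α)} (h : IsMaxFlag A l) :
    0 < l.length := by
  cases l <;> simp_all [IsMaxFlag]

theorem IsMaxFlag.getD_length_sub_one {α : Type*} {A : Finset α} {l : List (Finset α)}
    (h : IsMaxFlag A l) : l.getD (l.length - 1) ∅ = A := by
  have h2 := h.2.2
  rw [List.getLast?_eq_getElem?] at h2
  rw [List.getD_eq_getElem?_getD, h2, Option.getD_some]

theorem IsMaxFlag.getD_succ {α : Type*} {A : Finset α} {l : List (Finset α)} (h : IsMaxFlag A l)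
    {n : ℕ} (hn : n + 1 < l.length) :
    l.getD n ∅ ⊆ l.getD (n + 1) ∅ ∧ (l.getD (n + 1) ∅).card = (l.getD n ∅).card + 1 := by
  have hc := List.isChain_iff_getElem.1 h.1 n hn
  rwa [List.getD_eq_getElem _ _ hn, List.getD_eq_getElem _ _ (by omega)]

theorem IsMaxFlag.card_getD {α : Type*} {A : Finset α} {l : List (Finset α)} (h : IsMaxFlag A l)
    {n : ℕ} (hn : n < l.length) : (l.getD n ∅).card = n := by
  induction n with
  | zero => rw [h.getD_zero, Finset.card_empty]
  | succ n ih => rw [(h.getD_succ hn).2, ih (by omega)]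

theorem IsMaxFlag.length_eq {α : Type*} {A : Finset α} {l : List (Finset α)}
    (h : IsMaxFlag A l) : l.length = A.card + 1 := by
  have hpos := h.length_pos
  have hcard := h.card_getD (n := l.length - 1) (by omega)
  rw [h.getD_length_sub_one] at hcard
  omega

theorem IsMaxFlag.getD_subset_getD {α : Type*} {A : Finset α} {l : List (Finset α)}
    (h : IsMaxFlag A l) {m n : ℕ} (hmn : m ≤ n) (hn : n < l.length) :
    l.getD m ∅ ⊆ l.getD n ∅ := by
  induction n, hmn using Nat.le_induction with
  | base => exact subset_rfl
  | succ n _ ih => exact (ih (by omega)).trans (h.getD_succ hn).1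

theorem length_faceChainWord (f : V → ℕ) (l : List (Finset V)) :
    (faceChainWord f l).length = l.length - 1 := by
  simp [faceChainWord]

theorem getD_faceChainWord (f : V → ℕ) {l : List (Finset V)} {n : ℕ}
    (hn : n + 1 < l.length) :
    (faceChainWord f l).getD n 0 = (l.getD (n + 1) ∅ \ l.getD n ∅).sum f := by
  have hw : n < (faceChainWord f l).length := by rw [length_faceChainWord]; omega
  rw [List.getD_eq_getElem _ _ hw, List.getD_eq_getElem _ _ hn,
    List.getD_eq_getElem _ _ (by omega)]
  simp [faceChainWord]

/-- Suppose the vertices of `R` carry the last labels, and `e` contains `∅` and every member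
of the flag at which the label word descends. If the coatom of the flag contains `R`, then so
does some proper member of the flag lying in `e`. -/
theorem IsMaxFlag.exists_superset_of_coatom {A R : Finset V} {l : List (Finset V)}
    (h : IsMaxFlag A l) (f : V → ℕ) (hflast : ∀ w ∈ A, w ∉ R → ∀ v ∈ R, f w < f v)
    {c : ℕ} (hc : A.card = c + 1) (hR : R ⊆ l.getD c ∅) {e : Finset (Finset V)}
    (hbot : ∅ ∈ e)
    (hdesc : ∀ k : ℕ, k + 1 < (faceChainWord f l).length →
      (faceChainWord f l).getD (k + 1) 0 < (faceChainWord f l).getD k 0 →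
      l.getD (k + 1) ∅ ∈ e) :
    ∃ n ≤ c, l.getD n ∅ ∈ e ∧ R ⊆ l.getD n ∅ := by
  by_contra! hcon
  have hlen := h.length_eq
  have key : ∀ n ≤ c, R ⊆ l.getD n ∅ ∧ ∀ w ∈ R, (faceChainWord f l).getD n 0 < f w := by
    intro n hn
    induction hn using Nat.decreasingInduction with
    | self =>
      refine ⟨hR, fun w hw => ?_⟩
      obtain ⟨hsub, hcard⟩ := h.getD_succ (n := c) (by omega)
      have hone : (l.getD (c + 1) ∅ \ l.getD c ∅).card = 1 := by
        rw [Finset.card_sdiff_of_subset hsub]; omega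
      obtain ⟨v, hv⟩ := Finset.card_eq_one.1 hone
      have hmem : v ∈ l.getD (c + 1) ∅ \ l.getD c ∅ :=
        hv ▸ Finset.mem_singleton_self v
      rw [getD_faceChainWord f (by omega), hv, Finset.sum_singleton]
      have htop : l.getD (c + 1) ∅ = A := by
        rw [← h.getD_length_sub_one]; congr 1; omega
      rw [htop, Finset.mem_sdiff] at hmem
      exact hflast v hmem.1 (fun hvR => hmem.2 (hR hvR)) w hw
    | of_succ n hn ih =>
      obtain ⟨hsub, hlt⟩ := ih
      have hle : (faceChainWord f l).getD n 0 ≤ (faceChainWord f l).getD (n + 1) 0 := by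
        by_contra! hd
        exact hcon (n + 1) hn
          (hdesc n (by rw [length_faceChainWord]; omega) hd) hsub
      refine ⟨fun w hw => ?_, fun w hw => hle.trans_lt (hlt w hw)⟩
      by_contra hwn
      have hsum := Finset.single_le_sum (f := f) (fun _ _ => Nat.zero_le _)
        (Finset.mem_sdiff.2 ⟨hsub hw, hwn⟩)
      rw [← getD_faceChainWord f (by omega)] at hsum
      exact absurd (hle.trans_lt (hlt w hw)) (not_lt.2 hsum)
  exact hcon 0 (Nat.zero_le _) (by rwa [h.getD_zero]) (key 0 (Nat.zero_le _)).1

/-- let `F_1, …, F_r` be a shelling of a pure `(d−1)`-dimensional complex,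
with associated posets `P`, `P_i ≅ B_d`, and for each `i` let `λ_i` be the
`S_d`-EL-labeling of `P_i` induced by a bijection `φ_i : F_i → [d]` labeling the vertices
of the restriction face `r(F_i)` last.  If `e` is a non-maximal chain of `P_i`
(containing `0̂` and `1̂`) that is also a chain of `P_j` for some `j < i`, then
`Υ_{λ_i}(e)` is a chain of `P_k` for some `k < i`.

Here chains of `P_i` are modeled as chains of subsets of `F_i` (with `∅` representing
`0̂` and `F_i` itself representing `1̂`); a chain is a chain of `P_k` iff each element
either has rank `d` (is `1̂`) or is a subset of `F_k`; and `u = Υ_{λ_i}(e)` is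
characterized as the maximal chain of `P_i` containing `e` whose `λ_i`-label word has
descents only at positions crossing elements of `e`. -/
theorem upsilon_of_old_chain_is_old (d : ℕ) (K : Finset (Finset V))
    (hcx : IsComplex K) (hpure : IsPure d K)
    (F : List (Finset V)) (hF : IsShelling d K F)
    (r : ℕ → Finset V) (hr : IsRestrictionMap F r)
    (i : ℕ) (hi : i < F.length)
    (f : V → ℕ) (hfbij : Set.BijOn f (F.getD i ∅ : Set V) (Set.Icc 1 d))
    (hflast : ∀ w ∈ F.getD i ∅, w ∉ r i → ∀ v ∈ r i, f w < f v)
    (e : Finset (Finset V)) (hchain : IsChain (· ⊆ ·) (e : Set (Finset V)))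
    (hsub : ∀ y ∈ e, y ⊆ F.getD i ∅)
    (hbot : ∅ ∈ e) (htop : F.getD i ∅ ∈ e) (hnonmax : e.card ≤ d)
    (hold : ∃ j < i, ∀ y ∈ e, y.card = d ∨ y ⊆ F.getD j ∅)
    (u : List (Finset V)) (husat : IsMaxFlag (F.getD i ∅) u)
    (hue : ∀ y ∈ e, y ∈ u)
    (hudesc : ∀ k : ℕ, k + 1 < (faceChainWord f u).length →
      (faceChainWord f u).getD (k + 1) 0 < (faceChainWord f u).getD k 0 →
      u.getD (k + 1) ∅ ∈ e) :
    ∃ k < i, ∀ y ∈ u, y.card = d ∨ y ⊆ F.getD k ∅ := by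
  have hA : (F.getD i ∅).card = d := by
    rw [List.getD_eq_getElem _ _ hi]
    exact ((hF.2.1 _).1 (List.getElem_mem hi)).2
  have hlen := husat.length_eq
  obtain ⟨c, rfl⟩ : ∃ c, d = c + 1 :=
    Nat.exists_eq_add_one.2 ((Finset.card_pos.2 ⟨_, hbot⟩).trans_le hnonmax)
  obtain ⟨-, hnew, hmin⟩ := hr i hi
  suffices hco : ∃ k < i, u.getD c ∅ ⊆ F.getD k ∅ by
    obtain ⟨k, hk, hck⟩ := hco
    refine ⟨k, hk, fun y hy => ?_⟩
    obtain ⟨n, hn, rfl⟩ := List.getElem_of_mem hy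
    rw [← List.getD_eq_getElem _ ∅ hn, husat.card_getD hn]
    rcases Nat.lt_or_ge c n with h | h
    · left; omega
    · exact .inr ((husat.getD_subset_getD h (by omega)).trans hck)
  by_contra hco
  have hcA : u.getD c ∅ ⊆ F.getD i ∅ := by
    rw [← husat.getD_length_sub_one]
    exact husat.getD_subset_getD (by omega) (by omega)
  obtain ⟨n, hn, hne, hRn⟩ := husat.exists_superset_of_coatom f hflast hA
    (hmin _ hcA hco) hbot hudesc
  obtain ⟨j, hj, hej⟩ := hold
  rcases hej _ hne with h | h
  · rw [husat.card_getD (by omega)] at h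
    omega
  · exact hnew ⟨j, hj, hRn.trans h⟩
end

section
/- Let F_1, …, F_t be a shelling of a pure (d−1)-dimensional simplicial complex Σ, with associated posets P and P_1, …, P_t, and for each i let λ_i be the S_d-EL-labeling of P_i induced by a bijection φ_i: F_i → [d] that labels the vertices of the restriction face r(F_i) last. For each i, let Σ_i be the simplicial complex whose facets are the maximal chains of P_i (with 0̂ and 1̂ removed) that are not chains of P_j for any j < i. If S, T ⊆ [d−1] and S dominates T, then the number of maximal chains of Σ_i whose λ_i-labels have descent set S is at least the number of maximal chains of Σ_i whose λ_i-labels have descent set T. -/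
/-- The word `σ(1)σ(2)⋯σ(d)` of a permutation `σ ∈ S_d`, with letters in `{1,…,d}`. -/
def permWord {d : ℕ} (σ : Equiv.Perm (Fin d)) : List ℕ :=
  (List.finRange d).map fun i => (σ i : ℕ) + 1

/-- The descent set `{i ∈ [d−1] : σ(i) > σ(i+1)}` of a permutation `σ ∈ S_d`. -/
def descentSet {d : ℕ} (σ : Equiv.Perm (Fin d)) : Finset ℕ :=
  wordDescents (permWord σ)

/-- `τ` is obtained from `σ` by one switch: interchanging two adjacent letters
`σ(i) < σ(i+1)` of the word of `σ`. -/
def IsSwitch {d : ℕ} (σ τ : Equiv.Perm (Fin d)) : Prop :=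
  ∃ i j : Fin d, (i : ℕ) + 1 = (j : ℕ) ∧ σ i < σ j ∧ τ = σ * Equiv.swap i j

/-- `S` dominates `T` (as subsets of `[d−1]`): there is an injection
`φ : D_T^d → D_S^d` with `σ <_w φ(σ)` for all `σ ∈ D_T^d`, where `<_w` is the weak
order (a nonempty sequence of switches). -/
def Dominates (d : ℕ) (S T : Finset ℕ) : Prop :=
  ∃ φ : Equiv.Perm (Fin d) → Equiv.Perm (Fin d),
    Set.InjOn φ {σ | descentSet σ = T} ∧
    ∀ σ : Equiv.Perm (Fin d), descentSet σ = T →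
      descentSet (φ σ) = S ∧ Relation.TransGen IsSwitch σ (φ σ)

variable {V : Type*} [DecidableEq V]

/-- The facets of `Σ_i`: maximal chains of `P_i` that are not chains of `P_j` for any
`j < i` (an element of rank `d` is `1̂`, which lies in every `P_j`). -/
def SigmaFacet (d : ℕ) (F : List (Finset V)) (i : ℕ) : Set (List (Finset V)) :=
  {l | IsMaxFlag (F.getD i ∅) l ∧ ¬ ∃ j < i, ∀ y ∈ l, y.card = d ∨ y ⊆ F.getD j ∅}

/-- The set of the first `k` entries of the word `u`. -/
def prefixSet {d : ℕ} (u : Fin d → V) (k : ℕ) : Finset V :=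
  (Finset.univ.filter fun m : Fin d => (m : ℕ) < k).image u

/-- The flag that adds the entries of the word `u` one at a time. -/
def prefixFlag {d : ℕ} (u : Fin d → V) : List (Finset V) :=
  (List.range (d + 1)).map (prefixSet u)

theorem prefixSet_zero {d : ℕ} (u : Fin d → V) : prefixSet u 0 = ∅ := by
  simp [prefixSet]

theorem prefixSet_self {d : ℕ} (u : Fin d → V) : prefixSet u d = Finset.univ.image u := by
  simp [prefixSet]

theorem prefixSet_succ {d : ℕ} (u : Fin d → V) (k : Fin d) :
    prefixSet u (k + 1) = insert (u k) (prefixSet u k) := by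
  rw [prefixSet, prefixSet, ← Finset.image_insert]
  congr 1
  ext m
  simp [Fin.ext_iff]
  omega

theorem prefixSet_mono {d : ℕ} (u : Fin d → V) : Monotone (prefixSet u) := fun a b hab =>
  Finset.image_subset_image fun m hm => by
    simp only [Finset.mem_filter, Finset.mem_univ, true_and] at hm ⊢
    omega

theorem apply_mem_prefixSet_iff {d : ℕ} {u : Fin d → V} (hu : Function.Injective u)
    (m : Fin d) (k : ℕ) : u m ∈ prefixSet u k ↔ (m : ℕ) < k := by
  simp [prefixSet, hu.eq_iff]

theorem card_prefixSet {d : ℕ} {u : Fin d → V} (hu : Function.Injective u) {k : ℕ}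
    (hk : k ≤ d) : (prefixSet u k).card = k := by
  induction k with
  | zero => simp [prefixSet_zero]
  | succ k ih =>
    have h := prefixSet_succ u ⟨k, hk⟩
    simp only at h
    rw [h, Finset.card_insert_of_notMem (by simp [apply_mem_prefixSet_iff hu]), ih (by omega)]

theorem isMaxFlag_prefixFlag {d : ℕ} {u : Fin d → V} (hu : Function.Injective u) :
    IsMaxFlag (Finset.univ.image u) (prefixFlag u) := by
  refine ⟨?_, ?_, ?_⟩
  · refine List.isChain_iff_getElem.2 fun k hk => ?_
    simp only [prefixFlag, List.length_map, List.length_range] at hk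
    simp only [prefixFlag, List.getElem_map, List.getElem_range]
    rw [card_prefixSet hu (by omega), card_prefixSet hu (by omega)]
    exact ⟨prefixSet_mono u (Nat.le_succ k), rfl⟩
  · simp [prefixFlag, List.range_succ_eq_map, prefixSet_zero]
  · simp [prefixFlag, List.range_succ, prefixSet_self]

theorem IsMaxFlag.exists_eq_prefixFlag {d : ℕ} {A : Finset V} (hA : A.card = d)
    {l : List (Finset V)} (hl : IsMaxFlag A l) :
    ∃ u : Fin d → V, Function.Injective u ∧ Finset.univ.image u = A ∧ l = prefixFlag u := by
  obtain ⟨hchain, hhead, hlast⟩ := hl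
  have hstep := List.isChain_iff_getElem.1 hchain
  have hpos : 0 < l.length := by
    rw [List.length_pos_iff]
    rintro rfl
    simp at hhead
  have h0 : l[0] = ∅ := by
    rw [List.head?_eq_getElem?, List.getElem?_eq_getElem hpos] at hhead
    simpa using hhead
  have hcard : ∀ (k : ℕ) (hk : k < l.length), l[k].card = k := by
    intro k
    induction k with
    | zero => intro hk; simp [h0]
    | succ k ih => intro hk; rw [(hstep k hk).2, ih (by omega)]
  have htop : l[l.length - 1] = A := by
    rw [List.getLast?_eq_getElem?, List.getElem?_eq_getElem (by omega)] at hlast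
    simpa using hlast
  have hlen : l.length = d + 1 := by
    have h := hcard (l.length - 1) (by omega)
    rw [htop, hA] at h
    omega
  have hnew : ∀ k : Fin d, ∃ v, v ∉ l[(k : ℕ)] ∧ insert v l[(k : ℕ)] = l[(k : ℕ) + 1] := by
    intro k
    obtain ⟨hsub, hc⟩ := hstep k (by omega)
    obtain ⟨v, hv, h⟩ := Finset.exists_eq_insert_iff.2 ⟨hsub, hc.symm⟩
    exact ⟨v, hv, h⟩
  choose u hu_new hu_insert using hnew
  have hprefix : ∀ (k : ℕ) (hk : k < l.length), l[k] = prefixSet u k := by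
    intro k
    induction k with
    | zero => intro hk; rw [h0, prefixSet_zero]
    | succ k ih =>
      intro hk
      have h := prefixSet_succ u ⟨k, by omega⟩
      simp only at h
      rw [h, ← ih (by omega)]
      exact (hu_insert ⟨k, by omega⟩).symm
  have hne : ∀ a b : Fin d, a < b → u a ≠ u b := by
    intro a b hab h
    apply hu_new b
    rw [hprefix, ← h]
    exact Finset.mem_image_of_mem u (by simpa using hab)
  refine ⟨u, fun a b h => ?_, ?_, ?_⟩
  · rcases lt_trichotomy a b with hab | hab | hab
    · exact absurd h (hne a b hab)
    · exact hab
    · exact absurd h.symm (hne b a hab)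
  · rw [← prefixSet_self, ← htop, hprefix]
    congr 1
    omega
  · refine List.ext_getElem (by simp [prefixFlag, hlen]) fun k hk _ => ?_
    simp [prefixFlag, hprefix]

theorem faceChainWord_prefixFlag {d : ℕ} (f : V → ℕ) {u : Fin d → V}
    (hu : Function.Injective u) : faceChainWord f (prefixFlag u) = List.ofFn (f ∘ u) := by
  refine List.ext_getElem (by simp [faceChainWord, prefixFlag]) fun k hk hk' => ?_
  rw [List.length_ofFn] at hk'
  have h := prefixSet_succ u ⟨k, hk'⟩
  simp only at h
  have hnot : u ⟨k, hk'⟩ ∉ prefixSet u k := by simp [apply_mem_prefixSet_iff hu]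
  simp [faceChainWord, prefixFlag, h, Finset.insert_sdiff_of_notMem _ hnot]

theorem permWord_eq_ofFn {d : ℕ} (σ : Equiv.Perm (Fin d)) :
    permWord σ = List.ofFn fun m => (σ m : ℕ) + 1 := by
  simp [permWord, List.ofFn_eq_map]

theorem permWord_injective {d : ℕ} :
    Function.Injective (permWord : Equiv.Perm (Fin d) → List ℕ) := by
  intro σ τ h
  rw [permWord_eq_ofFn, permWord_eq_ofFn] at h
  ext m
  have := congrFun (List.ofFn_injective h) m
  simpa using this

/-- A flag of `F_i` is new exactly when its last added vertex is outside the restriction face. -/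
theorem prefixFlag_mem_sigmaFacet_iff {n : ℕ} {F : List (Finset V)} {r : ℕ → Finset V}
    (hr : IsRestrictionMap F r) {i : ℕ} (hi : i < F.length) {u : Fin (n + 1) → V}
    (hu : Function.Injective u) (himage : Finset.univ.image u = F.getD i ∅) :
    prefixFlag u ∈ SigmaFacet (n + 1) F i ↔ u (Fin.last n) ∉ r i := by
  have hflag : IsMaxFlag (F.getD i ∅) (prefixFlag u) := himage ▸ isMaxFlag_prefixFlag hu
  have hfacet : insert (u (Fin.last n)) (prefixSet u n) = F.getD i ∅ := by
    rw [← himage, ← prefixSet_self]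
    exact (prefixSet_succ u (Fin.last n)).symm
  have hearlier : ∀ j, (∀ y ∈ prefixFlag u, y.card = n + 1 ∨ y ⊆ F.getD j ∅) ↔
      prefixSet u n ⊆ F.getD j ∅ := by
    intro j
    constructor
    · intro h
      have hmem : prefixSet u n ∈ prefixFlag u :=
        List.mem_map_of_mem (List.mem_range.2 (by omega))
      refine (h _ hmem).resolve_left ?_
      rw [card_prefixSet hu (by omega)]
      omega
    · intro h y hy
      obtain ⟨k, hk, rfl⟩ := List.mem_map.1 hy
      rw [List.mem_range] at hk
      rcases Nat.lt_or_ge n k with hnk | hkn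
      · left
        rw [card_prefixSet hu (by omega)]
        omega
      · exact Or.inr ((prefixSet_mono u hkn).trans h)
  have hsub : prefixSet u n ⊆ F.getD i ∅ := hfacet ▸ Finset.subset_insert _ _
  have hface : r i ⊆ prefixSet u n ↔ ¬ ∃ j < i, prefixSet u n ⊆ F.getD j ∅ :=
    ⟨fun h ⟨j, hj, hj_sub⟩ => (hr i hi).2.1 ⟨j, hj, h.trans hj_sub⟩, (hr i hi).2.2 _ hsub⟩
  rw [SigmaFacet, Set.mem_ofPred_eq, and_iff_right hflag]
  simp only [hearlier]
  rw [← hface]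
  constructor
  · intro h hlast
    simpa [apply_mem_prefixSet_iff hu] using h hlast
  · intro h
    exact (Finset.subset_insert_iff_of_notMem h).1 (hfacet.symm ▸ (hr i hi).1)

/-- Going up in the weak order never increases the last letter. -/
theorem apply_last_le_of_transGen_isSwitch {n : ℕ} {σ τ : Equiv.Perm (Fin (n + 1))}
    (h : Relation.TransGen IsSwitch σ τ) : τ (Fin.last n) ≤ σ (Fin.last n) := by
  have hswitch : ∀ {σ τ : Equiv.Perm (Fin (n + 1))}, IsSwitch σ τ →
      τ (Fin.last n) ≤ σ (Fin.last n) := by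
    rintro σ _ ⟨a, b, hab, hlt, rfl⟩
    have ha : Fin.last n ≠ a := by
      rintro rfl
      have := b.isLt
      simp at hab
      omega
    rw [Equiv.Perm.mul_apply]
    by_cases hb : Fin.last n = b
    · subst hb
      rw [Equiv.swap_apply_right]
      exact hlt.le
    · rw [Equiv.swap_apply_of_ne_of_ne ha hb]
  induction h with
  | single h => exact hswitch h
  | tail _ h ih => exact (hswitch h).trans ih

/-- let `F_1, …, F_t` be a shelling of a pure `(d−1)`-dimensional complex,
with associated posets `P`, `P_i ≅ B_d`, and let `λ_i` be the `S_d`-EL-labeling of `P_i`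
induced by a bijection `φ_i : F_i → [d]` (here the vertex-labeling `f`) labeling the
vertices of the restriction face `r(F_i)` last.  Let `Σ_i` be the complex whose facets
are the maximal chains of `P_i` (with `0̂`, `1̂` removed) that are not chains of `P_j` for
any `j < i`.  If `S, T ⊆ [d−1]` and `S` dominates `T`, then the number of maximal chains
of `Σ_i` whose `λ_i`-labels have descent set `S` is at least the number of those whose
`λ_i`-labels have descent set `T`. -/
theorem sigma_descent_count_le (d : ℕ) (K : Finset (Finset V))
    (hcx : IsComplex K) (hpure : IsPure d K)
    (F : List (Finset V)) (hF : IsShelling d K F)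
    (r : ℕ → Finset V) (hr : IsRestrictionMap F r)
    (i : ℕ) (hi : i < F.length)
    (f : V → ℕ) (hfbij : Set.BijOn f (F.getD i ∅ : Set V) (Set.Icc 1 d))
    (hflast : ∀ w ∈ F.getD i ∅, w ∉ r i → ∀ v ∈ r i, f w < f v)
    (S T : Finset ℕ) (hS : S ⊆ Finset.Icc 1 (d - 1)) (hT : T ⊆ Finset.Icc 1 (d - 1))
    (hdom : Dominates d S T) :
    {l : List (Finset V) | l ∈ SigmaFacet d F i ∧
        wordDescents (faceChainWord f l) = T}.ncard ≤
      {l : List (Finset V) | l ∈ SigmaFacet d F i ∧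
        wordDescents (faceChainWord f l) = S}.ncard := by
  obtain _ | n := d
  · obtain rfl : S = ∅ := Finset.subset_empty.1 hS
    obtain rfl : T = ∅ := Finset.subset_empty.1 hT
    exact le_rfl
  have hcard : (F.getD i ∅).card = n + 1 := by
    have hmem : F.getD i ∅ ∈ F := by
      rw [List.getD_eq_getElem _ _ hi]
      exact List.getElem_mem hi
    exact ((hF.2.1 _).1 hmem).2
  have hlabel : ∀ k : Fin (n + 1), ∃ v ∈ F.getD i ∅, f v = k + 1 := fun k => by
    obtain ⟨v, hv, h⟩ := hfbij.surjOn (show (k : ℕ) + 1 ∈ Set.Icc 1 (n + 1) by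
      simp only [Set.mem_Icc]; omega)
    exact ⟨v, hv, h⟩
  choose g hg_mem hg_label using hlabel
  have hg_inj : Function.Injective g := fun a b h => by
    have h' := congrArg f h
    rw [hg_label, hg_label] at h'
    exact Fin.ext (by omega)
  have hinj : ∀ σ : Equiv.Perm (Fin (n + 1)), Function.Injective (g ∘ σ) := fun σ =>
    hg_inj.comp σ.injective
  have himage : ∀ u : Fin (n + 1) → V, Function.Injective u → (∀ k, u k ∈ F.getD i ∅) →
      Finset.univ.image u = F.getD i ∅ := by
    intro u hu hmem
    refine Finset.eq_of_subset_of_card_le ?_ ?_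
    · exact Finset.image_subset_iff.2 fun k _ => hmem k
    · rw [Finset.card_image_of_injective _ hu, hcard, Finset.card_univ, Fintype.card_fin]
  have hword : ∀ σ : Equiv.Perm (Fin (n + 1)),
      faceChainWord f (prefixFlag (g ∘ σ)) = permWord σ := by
    intro σ
    rw [faceChainWord_prefixFlag f (hinj σ), permWord_eq_ofFn]
    congr 1
    funext m
    exact hg_label (σ m)
  have hflag_inj : Function.Injective
      fun σ : Equiv.Perm (Fin (n + 1)) => prefixFlag (g ∘ σ) := by
    intro σ τ h
    apply permWord_injective
    rw [← hword, ← hword]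
    exact congrArg (faceChainWord f) h
  have hsigma : ∀ σ : Equiv.Perm (Fin (n + 1)),
      prefixFlag (g ∘ σ) ∈ SigmaFacet (n + 1) F i ↔ g (σ (Fin.last n)) ∉ r i := fun σ =>
    prefixFlag_mem_sigmaFacet_iff hr hi (hinj σ) (himage _ (hinj σ) fun k => hg_mem (σ k))
  have hset : ∀ U : Finset ℕ, {l : List (Finset V) | l ∈ SigmaFacet (n + 1) F i ∧
        wordDescents (faceChainWord f l) = U} =
      (fun σ : Equiv.Perm (Fin (n + 1)) => prefixFlag (g ∘ σ)) ''
        {σ | g (σ (Fin.last n)) ∉ r i ∧ descentSet σ = U} := by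
    intro U
    ext l
    constructor
    · rintro ⟨hl, hdes⟩
      obtain ⟨u, hu, hu_image, rfl⟩ := hl.1.exists_eq_prefixFlag hcard
      have hex : ∀ k, ∃ m, g m = u k := fun k => by
        have hk : u k ∈ Finset.univ.image g := by
          rw [himage g hg_inj hg_mem, ← hu_image]
          exact Finset.mem_image_of_mem u (Finset.mem_univ k)
        simpa using hk
      choose s hs using hex
      have hs_inj : Function.Injective s := fun a b h => hu (by rw [← hs, ← hs, h])
      obtain ⟨σ, rfl⟩ : ∃ σ : Equiv.Perm (Fin (n + 1)), g ∘ σ = u :=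
        ⟨Equiv.ofBijective s (Finite.injective_iff_bijective.1 hs_inj), funext hs⟩
      exact ⟨σ, ⟨(hsigma σ).1 hl, by rwa [hword] at hdes⟩, rfl⟩
    · rintro ⟨σ, ⟨hσ, hdes⟩, rfl⟩
      exact ⟨(hsigma σ).2 hσ, by rwa [hword]⟩
  obtain ⟨φ, hφ_inj, hφ⟩ := hdom
  rw [hset, hset, Set.ncard_image_of_injective _ hflag_inj,
    Set.ncard_image_of_injective _ hflag_inj]
  refine Set.ncard_le_ncard_of_injOn φ ?_ (hφ_inj.mono fun σ hσ => hσ.2) (Set.toFinite _)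
  rintro σ ⟨hσ, hdes⟩
  obtain ⟨hdes', hlt⟩ := hφ σ hdes
  refine ⟨fun hmem => ?_, hdes'⟩
  have hle : (φ σ (Fin.last n) : ℕ) ≤ σ (Fin.last n) := apply_last_le_of_transGen_isSwitch hlt
  have hlab := hflast _ (hg_mem (σ (Fin.last n))) hσ _ hmem
  rw [hg_label, hg_label] at hlab
  omega
end
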